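/- Let α ≥ 0, let k ≥ 1 be an integer, and let σ₁ ≤ σ₂ ≤ … ≤ σ_{k+1} be real numbers. Suppose u₁,…,u_k : ℝⁿ → ℝⁿ are smooth maps that vanish on ∂Ω, are orthonormal in L²(Ω, dm) (∫_Ω ⟨uᵢ, uⱼ⟩ dm = 1 if i = j and 0 otherwise), and satisfy 𝓛uᵢ + α∇(div_η uᵢ) = −σᵢ uᵢ at every point of Ω. Suppose moreover that σ_{k+1} has the min–max property: for every smooth w : ℝⁿ → ℝⁿ vanishing on ∂Ω with ∫_Ω ⟨w, uᵢ⟩ dm = 0 for i = 1,…,k, one has σ_{k+1} ∫_Ω |w|² dm ≤ ∫_Ω (⟨T(∇w), ∇w⟩ + α (div_η w)²) dm. Then Σ_{i=1}^k (σ_{k+1} − σᵢ)² ≤ (4δ(nδ + α)/(n²ε²)) · Σ_{i=1}^k (σ_{k+1} − σᵢ) · ( σᵢ − α‖div_η uᵢ‖² + (T₀² + 4C₀)/(4δ) ). -/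

import Mathlib

open MeasureTheory Real
open scoped RealInnerProductSpace BigOperators

noncomputable section

abbrev En (n : ℕ) := EuclideanSpace ℝ (Fin n)

/-- Divergence of a vector field on Euclidean space: trace of the derivative. -/
def vdiv {n : ℕ} (X : En n → En n) (x : En n) : ℝ :=
  ∑ i, fderiv ℝ X x (EuclideanSpace.single i 1) i

/-- Weighted divergence `div_η X = div X − ⟨∇η, X⟩`. -/
def vdivEta {n : ℕ} (η : En n → ℝ) (X : En n → En n) (x : En n) : ℝ :=
  vdiv X x - ⟪gradient η x, X x⟫

/-- The operator `𝓛 f = div_η (T (∇ f))`. -/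
def Lop {n : ℕ} (T : En n → (En n →L[ℝ] En n)) (η : En n → ℝ) (f : En n → ℝ) (x : En n) : ℝ :=
  vdivEta η (fun y => T y (gradient f y)) x

/-- The vector field `tr(∇T)(x) = ∑ i (D_{e i} T)(x)(e i)`. -/
def trGradT {n : ℕ} (T : En n → (En n →L[ℝ] En n)) (x : En n) : En n :=
  ∑ i, fderiv ℝ T x (EuclideanSpace.single i 1) (EuclideanSpace.single i 1)

/-- Lebesgue measure on `Ω`, weighted with density `e^{-η}`. -/
def wMeasure {n : ℕ} (η : En n → ℝ) (Ω : Set (En n)) : Measure (En n) :=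
  (volume.restrict Ω).withDensity fun x => ENNReal.ofReal (Real.exp (-η x))

section IntegrationByParts

variable {E : Type*} [NormedAddCommGroup E] [NormedSpace ℝ E]

/-- A preconnected set meeting both an open set and its complement meets its frontier. -/
lemma exists_mem_frontier_of_isPreconnected {X : Type*} [TopologicalSpace X] {s Ω : Set X}
    (hs : IsPreconnected s) (hΩ : IsOpen Ω) {x y : X} (hx : x ∈ s) (hxΩ : x ∈ Ω)
    (hy : y ∈ s) (hyΩ : y ∉ Ω) : ∃ z ∈ s, z ∈ frontier Ω := by
  by_contra! h
  have hout : ∀ z ∈ s, z ∉ Ω → z ∈ (closure Ω)ᶜ := fun z hz hzΩ hzc =>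
    h z hz (by rw [hΩ.frontier_eq]; exact ⟨hzc, hzΩ⟩)
  obtain ⟨z, -, hz, hz'⟩ := hs Ω (closure Ω)ᶜ hΩ isClosed_closure.isOpen_compl
    (fun z hz => by
      by_cases hzΩ : z ∈ Ω
      · exact Or.inl hzΩ
      · exact Or.inr (hout z hz hzΩ))
    ⟨x, hx, hxΩ⟩ ⟨y, hy, hout y hy hyΩ⟩
  exact hz' (subset_closure hz)

/-- The zero extension of a `C¹` function vanishing on the frontier of a bounded open set is
Lipschitz. -/
lemma exists_lipschitzWith_indicator [FiniteDimensional ℝ E] {Ω : Set E} (hΩ : IsOpen Ω)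
    (hΩb : Bornology.IsBounded Ω) {f : E → ℝ} (hf : ContDiff ℝ 1 f)
    (h0 : ∀ x ∈ frontier Ω, f x = 0) : ∃ C, LipschitzWith C (Ω.indicator f) := by
  have : ProperSpace E := FiniteDimensional.proper ℝ E
  obtain ⟨R, hR⟩ := hΩb.subset_closedBall (0 : E)
  have hRc : closure Ω ⊆ Metric.closedBall 0 R := closure_minimal hR Metric.isClosed_closedBall
  obtain ⟨C, hC⟩ := (isCompact_closedBall (0 : E) R).exists_bound_of_continuousOn
    (hf.continuous_fderiv (by norm_num)).continuousOn
  have hL : LipschitzOnWith C.toNNReal f (Metric.closedBall 0 R) :=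
    (convex_closedBall (0 : E) R).lipschitzOnWith_of_nnnorm_fderiv_le (𝕜 := ℝ)
      (fun x _ => hf.differentiable (by norm_num) x)
      (fun x hx => NNReal.le_toNNReal_of_coe_le (hC x hx))
  have hmixed : ∀ x ∈ Ω, ∀ y ∉ Ω, |f x| ≤ C.toNNReal * dist x y := by
    intro x hx y hy
    obtain ⟨z, hz, hzf⟩ := exists_mem_frontier_of_isPreconnected
      (convex_segment x y).isPreconnected hΩ (left_mem_segment ℝ x y) hx
      (right_mem_segment ℝ x y) hy
    have h1 := hL.dist_le_mul x (hR hx) z (hRc (frontier_subset_closure hzf))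
    rw [h0 z hzf, Real.dist_0_eq_abs] at h1
    refine h1.trans (mul_le_mul_of_nonneg_left ?_ C.toNNReal.2)
    have := dist_add_dist_of_mem_segment hz
    linarith [dist_nonneg (x := z) (y := y)]
  refine ⟨C.toNNReal, LipschitzWith.of_dist_le_mul fun x y => ?_⟩
  by_cases hx : x ∈ Ω <;> by_cases hy : y ∈ Ω
  · simpa [hx, hy] using hL.dist_le_mul x (hR hx) y (hR hy)
  · simpa [hx, hy, Real.dist_eq] using hmixed x hx y hy
  · simpa [hx, hy, Real.dist_eq, dist_comm] using hmixed y hy x hx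
  · simp only [hx, hy, not_false_eq_true, Set.indicator_of_notMem, dist_self]
    positivity

variable [MeasurableSpace E] [BorelSpace E] [FiniteDimensional ℝ E]
  (μ : Measure E) [μ.IsAddHaarMeasure]

/-- The derivative of a `C¹` function vanishes almost everywhere on its zero set. -/
lemma ae_fderiv_eq_zero_of_eq_zero {f : E → ℝ} (hf : ContDiff ℝ 1 f) :
    ∀ᵐ x ∂μ, f x = 0 → fderiv ℝ f x = 0 := by
  rcases subsingleton_or_nontrivial E with hE | hE
  · exact Filter.Eventually.of_forall fun x _ => Subsingleton.elim _ _
  obtain ⟨v, hv⟩ := exists_ne (0 : E)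
  have hms : MeasurableSet {x | f x = 0} :=
    (isClosed_singleton.preimage hf.continuous).measurableSet
  have happ : ApproximatesLinearOn (fun x => f x • v) (0 : E →L[ℝ] E) {x | f x = 0} 0 := by
    intro x hx y hy
    simp_all
  have := happ.norm_fderiv_sub_le μ hms (fun x => (fderiv ℝ f x).smulRight v)
    (fun x _ => ((hf.differentiable (by norm_num) x).hasFDerivAt.smul_const v).hasFDerivWithinAt)
  filter_upwards [(ae_restrict_iff' hms).1 this] with x hx hx0
  simpa [hv] using hx hx0

/-- The integral over a bounded open set of a directional derivative of a `C¹` function vanishing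
on the frontier is zero. -/
lemma integral_fderiv_eq_zero_of_frontier {Ω : Set E} (hΩ : IsOpen Ω)
    (hΩb : Bornology.IsBounded Ω) {f : E → ℝ} (hf : ContDiff ℝ 1 f)
    (h0 : ∀ x ∈ frontier Ω, f x = 0) (v : E) : ∫ x in Ω, fderiv ℝ f x v ∂μ = 0 := by
  have : ProperSpace E := FiniteDimensional.proper ℝ E
  obtain ⟨C, hC⟩ := exists_lipschitzWith_indicator hΩ hΩb hf h0
  have hcs : HasCompactSupport (Ω.indicator f) :=
    HasCompactSupport.of_support_subset_isCompact hΩb.isCompact_closure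
      (Set.support_indicator_subset.trans subset_closure)
  have key := LipschitzWith.integral_lineDeriv_mul_eq (μ := μ)
    (LipschitzWith.const (1 : ℝ) (α := E)) hC hcs (-v)
  have hae : (fun x => lineDeriv ℝ (Ω.indicator f) x v) =ᵐ[μ]
      Ω.indicator fun x => fderiv ℝ f x v := by
    filter_upwards [ae_fderiv_eq_zero_of_eq_zero μ hf] with x hx
    by_cases hxΩ : x ∈ Ω
    · have he : Ω.indicator f =ᶠ[nhds x] f := by
        filter_upwards [hΩ.mem_nhds hxΩ] with y hy using Set.indicator_of_mem hy f
      rw [Set.indicator_of_mem hxΩ, he.lineDeriv_eq,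
        (hf.differentiable (by norm_num) x).lineDeriv_eq_fderiv]
    rw [Set.indicator_of_notMem hxΩ]
    by_cases hxc : x ∈ closure Ω
    · have hxf : f x = 0 := h0 x (by rw [hΩ.frontier_eq]; exact ⟨hxc, hxΩ⟩)
      have hd : HasFDerivAt f (0 : E →L[ℝ] ℝ) x := by
        rw [← hx hxf]; exact (hf.differentiable (by norm_num) x).hasFDerivAt
      have hg : HasFDerivAt (Ω.indicator f) (0 : E →L[ℝ] ℝ) x := by
        rw [hasFDerivAt_iff_isLittleO] at hd ⊢
        refine Asymptotics.IsBigO.trans_isLittleO (Asymptotics.IsBigO.of_bound 1 ?_) hd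
        refine Filter.Eventually.of_forall fun y => ?_
        by_cases hy : y ∈ Ω <;> simp [hxΩ, hxf, hy]
      simpa using (hg.hasLineDerivAt v).lineDeriv
    · have he : Ω.indicator f =ᶠ[nhds x] fun _ => 0 := by
        filter_upwards [isClosed_closure.isOpen_compl.mem_nhds hxc] with y hy
        exact Set.indicator_of_notMem (fun h => hy (subset_closure h)) f
      rw [he.lineDeriv_eq]
      simp [lineDeriv]
  rw [← integral_indicator hΩ.measurableSet, ← integral_congr_ae hae]
  simpa [lineDeriv] using key.symm

end IntegrationByParts

section Calculus

variable {n : ℕ}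

lemma gradient_apply (f : En n → ℝ) (x : En n) (i : Fin n) :
    gradient f x i = fderiv ℝ f x (EuclideanSpace.single i 1) := by
  rw [← inner_gradient_left, EuclideanSpace.inner_single_right]
  simp

lemma contDiff_gradient {f : En n → ℝ} (hf : ContDiff ℝ (⊤ : ℕ∞) f) :
    ContDiff ℝ (⊤ : ℕ∞) (gradient f) := by
  rw [contDiff_euclidean]
  intro i
  simp_rw [gradient_apply]
  exact (hf.fderiv_right (m := (⊤ : ℕ∞)) (by simp)).clm_apply contDiff_const

lemma contDiff_coord {X : En n → En n} {m : WithTop ℕ∞} (hX : ContDiff ℝ m X) (l : Fin n) :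
    ContDiff ℝ m fun y => X y l :=
  contDiff_euclidean.1 hX l

lemma contDiff_vdiv {X : En n → En n} (hX : ContDiff ℝ (⊤ : ℕ∞) X) :
    ContDiff ℝ (⊤ : ℕ∞) (vdiv X) :=
  ContDiff.sum fun i _ =>
    contDiff_coord ((hX.fderiv_right (m := (⊤ : ℕ∞)) (by simp)).clm_apply contDiff_const) i

lemma contDiff_vdivEta {η : En n → ℝ} (hη : ContDiff ℝ (⊤ : ℕ∞) η) {X : En n → En n}
    (hX : ContDiff ℝ (⊤ : ℕ∞) X) : ContDiff ℝ (⊤ : ℕ∞) (vdivEta η X) :=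
  (contDiff_vdiv hX).sub ((contDiff_gradient hη).inner ℝ hX)

lemma contDiff_trGradT {T : En n → (En n →L[ℝ] En n)} (hT : ContDiff ℝ (⊤ : ℕ∞) T) :
    ContDiff ℝ (⊤ : ℕ∞) (trGradT T) :=
  ContDiff.sum fun _ _ =>
    ((hT.fderiv_right (m := (⊤ : ℕ∞)) (by simp)).clm_apply contDiff_const).clm_apply contDiff_const

lemma fderiv_coord {X : En n → En n} {x : En n} (hX : DifferentiableAt ℝ X x) (l : Fin n)
    (v : En n) : fderiv ℝ (fun y => X y l) x v = fderiv ℝ X x v l := by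
  have h := ((EuclideanSpace.proj l : En n →L[ℝ] ℝ).hasFDerivAt.comp x hX.hasFDerivAt)
  have h' : HasFDerivAt (fun y => X y l) ((EuclideanSpace.proj l : En n →L[ℝ] ℝ).comp
    (fderiv ℝ X x)) x := h
  rw [h'.fderiv]
  rfl

lemma vdiv_eq_sum {X : En n → En n} {x : En n} (hX : DifferentiableAt ℝ X x) :
    vdiv X x = ∑ i, fderiv ℝ (fun y => X y i) x (EuclideanSpace.single i 1) := by
  simp_rw [vdiv, fderiv_coord hX]

lemma gradient_mul_fun {f g : En n → ℝ} {x : En n} (hf : DifferentiableAt ℝ f x)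
    (hg : DifferentiableAt ℝ g x) :
    gradient (fun y => f y * g y) x = f x • gradient g x + g x • gradient f x := by
  simp [gradient, fderiv_fun_mul hf hg]

lemma gradient_sum_const_mul {ι : Type*} (s : Finset ι) (b : ι → ℝ) {g : ι → En n → ℝ} {x : En n}
    (hg : ∀ i ∈ s, DifferentiableAt ℝ (g i) x) :
    gradient (fun y => ∑ i ∈ s, b i * g i y) x = ∑ i ∈ s, b i • gradient (g i) x := by
  rw [gradient, fderiv_fun_sum fun i hi => (hg i hi).const_mul (b i), map_sum]
  refine Finset.sum_congr rfl fun i hi => ?_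
  simp [gradient, fderiv_const_mul (hg i hi)]

lemma gradient_coord (p : Fin n) (x : En n) :
    gradient (fun y : En n => y p) x = EuclideanSpace.single p 1 := by
  refine HasGradientAt.gradient ?_
  rw [hasGradientAt_iff_hasFDerivAt]
  refine ((EuclideanSpace.proj p : En n →L[ℝ] ℝ).hasFDerivAt (x := x)).congr_fderiv ?_
  ext v
  simp [EuclideanSpace.inner_single_left]

lemma vdivEta_add (η : En n → ℝ) {X Y : En n → En n} {x : En n} (hX : DifferentiableAt ℝ X x)
    (hY : DifferentiableAt ℝ Y x) :
    vdivEta η (fun y => X y + Y y) x = vdivEta η X x + vdivEta η Y x := by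
  simp only [vdivEta, vdiv, fderiv_fun_add hX hY, inner_add_right, add_apply,
    PiLp.add_apply, Finset.sum_add_distrib]
  ring

lemma vdivEta_sum (η : En n → ℝ) {ι : Type*} (s : Finset ι) {X : ι → En n → En n} {x : En n}
    (hX : ∀ i, DifferentiableAt ℝ (X i) x) :
    vdivEta η (fun y => ∑ i ∈ s, X i y) x = ∑ i ∈ s, vdivEta η (X i) x := by
  classical
  induction s using Finset.induction_on with
  | empty => simp [vdivEta, vdiv]
  | insert a s ha ih =>
    simp only [Finset.sum_insert ha]
    rw [vdivEta_add η (hX a) (DifferentiableAt.fun_sum fun i _ => hX i), ih]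

lemma vdivEta_smul (η : En n → ℝ) {f : En n → ℝ} {X : En n → En n} {x : En n}
    (hf : DifferentiableAt ℝ f x) (hX : DifferentiableAt ℝ X x) :
    vdivEta η (fun y => f y • X y) x = f x * vdivEta η X x + ⟪gradient f x, X x⟫ := by
  have h : ⟪gradient f x, X x⟫ = ∑ i, fderiv ℝ f x (EuclideanSpace.single i 1) * X x i := by
    simp only [PiLp.inner_apply, gradient_apply]
    exact Finset.sum_congr rfl fun i _ => by simp [mul_comm]
  rw [h]
  simp only [vdivEta, vdiv, fderiv_fun_smul hf hX, inner_smul_right]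
  simp only [add_apply, smul_apply, ContinuousLinearMap.smulRight_apply,
    PiLp.add_apply, PiLp.smul_apply, smul_eq_mul, Finset.sum_add_distrib, ← Finset.mul_sum]
  ring

lemma vdivEta_const_smul (η : En n → ℝ) (c : ℝ) {X : En n → En n} {x : En n}
    (hX : DifferentiableAt ℝ X x) :
    vdivEta η (fun y => c • X y) x = c * vdivEta η X x := by
  have := vdivEta_smul η (differentiableAt_const (x := x) c) hX
  simpa using this

end Calculus

section WeightedMeasure

variable {n : ℕ} {η : En n → ℝ} {Ω : Set (En n)}

lemma integral_wMeasure (hη : Continuous η) (g : En n → ℝ) :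
    ∫ x, g x ∂(wMeasure η Ω) = ∫ x in Ω, Real.exp (-η x) * g x := by
  rw [wMeasure, integral_withDensity_eq_integral_toReal_smul (by fun_prop) (by simp)]
  simp [ENNReal.toReal_ofReal (Real.exp_pos _).le]

lemma ContDiff.integrable_wMeasure {m : WithTop ℕ∞} (hη : Continuous η) (hΩ : Bornology.IsBounded Ω)
    {g : En n → ℝ} (hg : ContDiff ℝ m g) : Integrable g (wMeasure η Ω) := by
  rw [wMeasure, integrable_withDensity_iff_integrable_smul' (by fun_prop) (by simp)]
  have hc : Continuous fun x => Real.exp (-η x) * g x := by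
    have := hg.continuous
    fun_prop
  have h := (hc.continuousOn.integrableOn_compact (μ := volume) hΩ.isCompact_closure).mono_set
    subset_closure
  simpa [ENNReal.toReal_ofReal (Real.exp_pos _).le, IntegrableOn] using h

lemma ae_wMeasure_mem (hΩ : IsOpen Ω) : ∀ᵐ x ∂(wMeasure η Ω), x ∈ Ω :=
  (withDensity_absolutelyContinuous _ _).ae_le (ae_restrict_mem hΩ.measurableSet)

/-- The divergence theorem for vector fields vanishing on the frontier. -/
lemma integral_vdivEta_eq_zero (hΩ : IsOpen Ω) (hΩb : Bornology.IsBounded Ω)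
    (hη : ContDiff ℝ (⊤ : ℕ∞) η) {X : En n → En n} (hX : ContDiff ℝ (⊤ : ℕ∞) X)
    (h0 : ∀ x ∈ frontier Ω, X x = 0) : ∫ x, vdivEta η X x ∂(wMeasure η Ω) = 0 := by
  have hexp : ContDiff ℝ (⊤ : ℕ∞) fun y => Real.exp (-η y) := Real.contDiff_exp.comp hη.neg
  set Y : En n → En n := fun y => Real.exp (-η y) • X y with hY
  have hYs : ContDiff ℝ (⊤ : ℕ∞) Y := hexp.smul hX
  have hηd : Differentiable ℝ η := hη.differentiable (by simp)
  have hgrad : ∀ x, gradient (fun y => Real.exp (-η y)) x = -(Real.exp (-η x)) • gradient η x := by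
    intro x
    have h : HasFDerivAt (fun y => Real.exp (-η y)) (Real.exp (-η x) • -fderiv ℝ η x) x :=
      (hηd x).hasFDerivAt.neg.exp
    rw [gradient, h.fderiv]
    simp [gradient]
  have hpt : ∀ x, Real.exp (-η x) * vdivEta η X x
      = ∑ i, fderiv ℝ (fun y => Y y i) x (EuclideanSpace.single i 1) := by
    intro x
    rw [← vdiv_eq_sum (hYs.differentiable (by simp) x)]
    have h1 := vdivEta_smul η (hexp.differentiable (by simp) x) (hX.differentiable (by simp) x)
    have h2 : vdivEta η Y x = vdiv Y x - ⟪gradient η x, Y x⟫ := rfl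
    rw [h2, hgrad] at h1
    simp only [hY, inner_smul_right, inner_smul_left] at h1 ⊢
    simp only [conj_trivial] at h1
    linarith
  rw [integral_wMeasure hη.continuous]
  simp_rw [hpt]
  rw [integral_finsetSum]
  · refine Finset.sum_eq_zero fun i _ =>
      integral_fderiv_eq_zero_of_frontier volume hΩ hΩb
        ((contDiff_coord hYs i).of_le (by exact_mod_cast le_top)) (fun x hx => ?_) _
    simp [hY, h0 x hx]
  · intro i _
    have hc : Continuous fun x => fderiv ℝ (fun y => Y y i) x (EuclideanSpace.single i 1) :=
      ((contDiff_coord hYs i).continuous_fderiv (by simp)).clm_apply continuous_const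
    exact (hc.continuousOn.integrableOn_compact (μ := volume) hΩb.isCompact_closure).mono_set
      subset_closure

/-- Integration by parts: no boundary term appears when `f • X` vanishes on the frontier. -/
lemma integral_mul_vdivEta (hΩ : IsOpen Ω) (hΩb : Bornology.IsBounded Ω)
    (hη : ContDiff ℝ (⊤ : ℕ∞) η) {f : En n → ℝ} (hf : ContDiff ℝ (⊤ : ℕ∞) f) {X : En n → En n}
    (hX : ContDiff ℝ (⊤ : ℕ∞) X) (h0 : ∀ x ∈ frontier Ω, f x = 0) :
    ∫ x, (f x * vdivEta η X x + ⟪gradient f x, X x⟫) ∂(wMeasure η Ω) = 0 := by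
  rw [← integral_vdivEta_eq_zero hΩ hΩb hη (hf.smul hX) (fun x hx => by simp [h0 x hx])]
  refine integral_congr_ae (Filter.Eventually.of_forall fun x => ?_)
  exact (vdivEta_smul η (hf.differentiable (by simp) x) (hX.differentiable (by simp) x)).symm

end WeightedMeasure

section Energy

variable {n : ℕ}

/-- The symmetric bilinear density `⟨T ∇v, ∇w⟩ + α div_η v div_η w`. -/
def energyDensity (T : En n → (En n →L[ℝ] En n)) (η : En n → ℝ) (α : ℝ) (v w : En n → En n)
    (x : En n) : ℝ :=
  (∑ l, ⟪T x (gradient (fun y => v y l) x), gradient (fun y => w y l) x⟫)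
    + α * (vdivEta η v x * vdivEta η w x)

variable {T : En n → (En n →L[ℝ] En n)} {η : En n → ℝ} {α : ℝ}

lemma energyDensity_comm (hTsym : ∀ x v w, ⟪T x v, w⟫ = ⟪v, T x w⟫) (v w : En n → En n)
    (x : En n) : energyDensity T η α v w x = energyDensity T η α w v x := by
  rw [energyDensity, energyDensity, mul_comm (vdivEta η v x)]
  congr 1
  exact Finset.sum_congr rfl fun l _ => by rw [hTsym, real_inner_comm]

lemma contDiff_energyDensity (hT : ContDiff ℝ (⊤ : ℕ∞) T) (hη : ContDiff ℝ (⊤ : ℕ∞) η)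
    {v w : En n → En n} (hv : ContDiff ℝ (⊤ : ℕ∞) v) (hw : ContDiff ℝ (⊤ : ℕ∞) w) :
    ContDiff ℝ (⊤ : ℕ∞) (energyDensity T η α v w) :=
  (ContDiff.sum fun l _ => (hT.clm_apply (contDiff_gradient (contDiff_coord hv l))).inner ℝ
    (contDiff_gradient (contDiff_coord hw l))).add
    (contDiff_const.mul ((contDiff_vdivEta hη hv).mul (contDiff_vdivEta hη hw)))

lemma energyDensity_add_left {v v' : En n → En n} (w : En n → En n) {x : En n}
    (hv : DifferentiableAt ℝ v x) (hv' : DifferentiableAt ℝ v' x) :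
    energyDensity T η α (fun y => v y + v' y) w x
      = energyDensity T η α v w x + energyDensity T η α v' w x := by
  have hg : ∀ l : Fin n, gradient (fun y => v y l + v' y l) x
      = gradient (fun y => v y l) x + gradient (fun y => v' y l) x := fun l => by
    have h1 : DifferentiableAt ℝ (fun y => v y l) x := by fun_prop
    have h2 : DifferentiableAt ℝ (fun y => v' y l) x := by fun_prop
    simp [gradient, fderiv_fun_add h1 h2]
  simp only [energyDensity, PiLp.add_apply, hg, map_add, inner_add_left, Finset.sum_add_distrib,
    vdivEta_add η hv hv']
  ring

lemma energyDensity_const_smul_left (c : ℝ) {v : En n → En n} (w : En n → En n) {x : En n}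
    (hv : DifferentiableAt ℝ v x) :
    energyDensity T η α (fun y => c • v y) w x = c * energyDensity T η α v w x := by
  have hg : ∀ l : Fin n, gradient (fun y => c * v y l) x
      = c • gradient (fun y => v y l) x := fun l => by
    have h1 : DifferentiableAt ℝ (fun y => v y l) x := by fun_prop
    simp [gradient, fderiv_const_mul h1]
  simp only [energyDensity, PiLp.smul_apply, smul_eq_mul, hg, map_smul, inner_smul_left,
    vdivEta_const_smul η c hv, conj_trivial, ← Finset.mul_sum]
  ring

lemma energyDensity_sum_left {ι : Type*} (s : Finset ι) {v : ι → En n → En n} (w : En n → En n)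
    {x : En n} (hv : ∀ i, DifferentiableAt ℝ (v i) x) :
    energyDensity T η α (fun y => ∑ i ∈ s, v i y) w x
      = ∑ i ∈ s, energyDensity T η α (v i) w x := by
  classical
  induction s using Finset.induction_on with
  | empty => simp [energyDensity, vdivEta, vdiv]
  | insert a s ha ih =>
    simp only [Finset.sum_insert ha]
    rw [energyDensity_add_left w (hv a) (DifferentiableAt.fun_sum fun i _ => hv i), ih]

lemma gradient_mul_coord {f : En n → ℝ} {v : En n → En n} {x : En n}
    (hf : DifferentiableAt ℝ f x) (hv : DifferentiableAt ℝ v x) (l : Fin n) :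
    gradient (fun y => f y * v y l) x
      = f x • gradient (fun y => v y l) x + v x l • gradient f x :=
  gradient_mul_fun hf (by fun_prop)

lemma energyDensity_smul_smul (hTsym : ∀ x v w, ⟪T x v, w⟫ = ⟪v, T x w⟫) {f : En n → ℝ}
    {v : En n → En n} {x : En n} (hf : DifferentiableAt ℝ f x) (hv : DifferentiableAt ℝ v x) :
    energyDensity T η α (fun y => f y • v y) (fun y => f y • v y) x
      = energyDensity T η α v (fun y => (f y * f y) • v y) x
        + (‖v x‖ ^ 2 * ⟪T x (gradient f x), gradient f x⟫ + α * ⟪gradient f x, v x⟫ ^ 2) := by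
  have hn : ‖v x‖ ^ 2 = ∑ l, v x l * v x l := by
    rw [← real_inner_self_eq_norm_sq, PiLp.inner_apply]
    simp [sq]
  have hff : DifferentiableAt ℝ (fun y => f y * f y) x := hf.mul hf
  simp only [energyDensity, PiLp.smul_apply, smul_eq_mul, gradient_mul_coord hf hv,
    gradient_mul_coord hff hv, gradient_mul_fun hf hf, vdivEta_smul η hf hv,
    vdivEta_smul η hff hv, hn, Finset.sum_mul]
  have hs : ∀ l : Fin n,
      ⟪T x (f x • gradient (fun y => v y l) x + v x l • gradient f x),
          f x • gradient (fun y => v y l) x + v x l • gradient f x⟫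
        = ⟪T x (gradient (fun y => v y l) x), (f x * f x) • gradient (fun y => v y l) x
            + v x l • (f x • gradient f x + f x • gradient f x)⟫
          + v x l * v x l * ⟪T x (gradient f x), gradient f x⟫ := fun l => by
    have hc : ⟪T x (gradient f x), gradient (fun y => v y l) x⟫
        = ⟪T x (gradient (fun y => v y l) x), gradient f x⟫ := by
      rw [hTsym, real_inner_comm]
    simp only [map_add, map_smul, inner_add_left, inner_add_right, inner_smul_left,
      inner_smul_right, conj_trivial, hc]
    ring
  simp only [hs, Finset.sum_add_distrib, inner_add_left, inner_smul_left, conj_trivial]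
  ring

variable {Ω : Set (En n)}

/-- The weak formulation of `𝓛 v + α ∇(div_η v) = -s v`, tested with a field vanishing on the
frontier. -/
lemma integral_energyDensity_eq (hΩ : IsOpen Ω) (hΩb : Bornology.IsBounded Ω)
    (hη : ContDiff ℝ (⊤ : ℕ∞) η) (hT : ContDiff ℝ (⊤ : ℕ∞) T) {s : ℝ} {v w : En n → En n}
    (hv : ContDiff ℝ (⊤ : ℕ∞) v) (hw : ContDiff ℝ (⊤ : ℕ∞) w)
    (hw0 : ∀ x ∈ frontier Ω, w x = 0)
    (heig : ∀ x ∈ Ω, ∀ l : Fin n,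
      Lop T η (fun y => v y l) x + α * gradient (vdivEta η v) x l = -s * v x l) :
    ∫ x, energyDensity T η α v w x ∂(wMeasure η Ω) = s * ∫ x, ⟪v x, w x⟫ ∂(wMeasure η Ω) := by
  have hTg : ∀ l : Fin n, ContDiff ℝ (⊤ : ℕ∞) fun y => T y (gradient (fun z => v z l) y) :=
    fun l => hT.clm_apply (contDiff_gradient (contDiff_coord hv l))
  have hdiv : ContDiff ℝ (⊤ : ℕ∞) fun y => α * vdivEta η v y :=
    contDiff_const.mul (contDiff_vdivEta hη hv)
  have hA : ∀ l : Fin n, ContDiff ℝ (⊤ : ℕ∞) fun y => w y l • T y (gradient (fun z => v z l) y) :=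
    fun l => (contDiff_coord hw l).smul (hTg l)
  have hB : ContDiff ℝ (⊤ : ℕ∞) fun y => (α * vdivEta η v y) • w y := hdiv.smul hw
  have hpt : ∀ x ∈ Ω, vdivEta η (fun y => (∑ l, w y l • T y (gradient (fun z => v z l) y))
      + (α * vdivEta η v y) • w y) x = energyDensity T η α v w x - s * ⟪v x, w x⟫ := by
    intro x hx
    have hgd : gradient (fun y => α * vdivEta η v y) x = α • gradient (vdivEta η v) x := by
      simp [gradient, fderiv_const_mul ((contDiff_vdivEta hη hv).differentiable (by simp) x)]
    rw [vdivEta_add η ((ContDiff.sum fun l _ => hA l).differentiable (by simp) x)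
        (hB.differentiable (by simp) x),
      vdivEta_sum η _ (fun l => (hA l).differentiable (by simp) x),
      vdivEta_smul η (hdiv.differentiable (by simp) x) (hw.differentiable (by simp) x), hgd]
    simp_rw [fun l : Fin n => vdivEta_smul η ((contDiff_coord hw l).differentiable (by simp) x)
      ((hTg l).differentiable (by simp) x)]
    have h1 : ⟪α • gradient (vdivEta η v) x, w x⟫
        = ∑ l, w x l * (α * gradient (vdivEta η v) x l) := by
      simp only [PiLp.inner_apply]
      exact Finset.sum_congr rfl fun i _ => by simp
    have h2 : s * ⟪v x, w x⟫ = -∑ l, w x l * (-s * v x l) := by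
      simp only [PiLp.inner_apply, Finset.mul_sum, ← Finset.sum_neg_distrib]
      exact Finset.sum_congr rfl fun i _ => by simp; ring
    have h3 : ∑ l, w x l * (-s * v x l)
        = ∑ l, w x l * vdivEta η (fun y => T y (gradient (fun z => v z l) y)) x
          + ∑ l, w x l * (α * gradient (vdivEta η v) x l) := by
      rw [← Finset.sum_add_distrib]
      exact Finset.sum_congr rfl fun l _ => by rw [← heig x hx l, mul_add]; rfl
    rw [h1, h2, h3, energyDensity, Finset.sum_add_distrib]
    simp only [real_inner_comm]
    ring
  have hzero := integral_vdivEta_eq_zero hΩ hΩb hη ((ContDiff.sum (s := Finset.univ) fun l _ => hA l).add hB)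
    (fun x hx => by simp [hw0 x hx])
  rw [integral_congr_ae ((ae_wMeasure_mem hΩ).mono hpt), integral_sub, integral_const_mul] at hzero
  · linarith
  · exact (contDiff_energyDensity hT hη hv hw).integrable_wMeasure hη.continuous hΩb
  · exact ((hv.inner ℝ hw).integrable_wMeasure hη.continuous hΩb).const_mul s

end Energy

section Orthonormal

variable {n : ℕ} {η : En n → ℝ} {Ω : Set (En n)}

lemma integral_norm_sub_sq_eq (hη : Continuous η) (hΩb : Bornology.IsBounded Ω)
    {F G : En n → En n} (hF : ContDiff ℝ (⊤ : ℕ∞) F) (hG : ContDiff ℝ (⊤ : ℕ∞) G) :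
    ∫ x, ‖F x - G x‖ ^ 2 ∂(wMeasure η Ω) = ∫ x, ‖F x‖ ^ 2 ∂(wMeasure η Ω)
      - ∫ x, ⟪G x, F x⟫ ∂(wMeasure η Ω) - ∫ x, ⟪G x, F x - G x⟫ ∂(wMeasure η Ω) := by
  have hpt : ∀ x, ‖F x - G x‖ ^ 2 = ‖F x‖ ^ 2 - ⟪G x, F x⟫ - ⟪G x, F x - G x⟫ := by
    intro x
    rw [norm_sub_sq_real, inner_sub_right, real_inner_self_eq_norm_sq, real_inner_comm]
    ring
  have hi1 : Integrable (fun x => ‖F x‖ ^ 2) (wMeasure η Ω) :=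
    (hF.norm_sq ℝ).integrable_wMeasure hη hΩb
  have hi2 := (hG.inner ℝ hF).integrable_wMeasure hη hΩb
  have hi3 := (hG.inner ℝ (hF.sub hG)).integrable_wMeasure hη hΩb
  have e1 := integral_sub (hi1.sub hi2) hi3
  have e2 := integral_sub hi1 hi2
  simp only [Pi.sub_apply] at e1
  rw [← e2, ← e1]
  exact integral_congr_ae (Filter.Eventually.of_forall hpt)

variable {ι : Type*} [Fintype ι]
  {u : ι → En n → En n}

lemma integral_inner_sum_smul (hη : Continuous η) (hΩb : Bornology.IsBounded Ω)
    (hu : ∀ i, ContDiff ℝ (⊤ : ℕ∞) (u i)) (b : ι → ℝ) {w : En n → En n}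
    (hw : ContDiff ℝ (⊤ : ℕ∞) w) :
    ∫ x, ⟪∑ j, b j • u j x, w x⟫ ∂(wMeasure η Ω) = ∑ j, b j * ∫ x, ⟪u j x, w x⟫ ∂(wMeasure η Ω) := by
  simp_rw [sum_inner, inner_smul_left, conj_trivial]
  rw [integral_finsetSum _ fun j _ => (((hu j).inner ℝ hw).integrable_wMeasure hη hΩb).const_mul _]
  simp_rw [integral_const_mul]

variable [DecidableEq ι]

lemma integral_inner_sub_projection (hη : Continuous η) (hΩb : Bornology.IsBounded Ω)
    (hu : ∀ i, ContDiff ℝ (⊤ : ℕ∞) (u i))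
    (horth : ∀ i j, ∫ x, ⟪u i x, u j x⟫ ∂(wMeasure η Ω) = if i = j then 1 else 0)
    {F : En n → En n} (hF : ContDiff ℝ (⊤ : ℕ∞) F) {b : ι → ℝ}
    (hb : ∀ j, ∫ x, ⟪F x, u j x⟫ ∂(wMeasure η Ω) = b j) (i : ι) :
    ∫ x, ⟪F x - ∑ j, b j • u j x, u i x⟫ ∂(wMeasure η Ω) = 0 := by
  have hG : ContDiff ℝ (⊤ : ℕ∞) fun x => ∑ j, b j • u j x :=
    ContDiff.sum fun j _ => (hu j).const_smul _
  simp_rw [inner_sub_left]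
  rw [integral_sub ((hF.inner ℝ (hu i)).integrable_wMeasure hη hΩb)
    ((hG.inner ℝ (hu i)).integrable_wMeasure hη hΩb),
    integral_inner_sum_smul hη hΩb hu _ (hu i), hb]
  simp [horth]

lemma integral_norm_sub_projection_sq (hη : Continuous η) (hΩb : Bornology.IsBounded Ω)
    (hu : ∀ i, ContDiff ℝ (⊤ : ℕ∞) (u i))
    (horth : ∀ i j, ∫ x, ⟪u i x, u j x⟫ ∂(wMeasure η Ω) = if i = j then 1 else 0)
    {F : En n → En n} (hF : ContDiff ℝ (⊤ : ℕ∞) F) {b : ι → ℝ}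
    (hb : ∀ j, ∫ x, ⟪F x, u j x⟫ ∂(wMeasure η Ω) = b j) :
    ∫ x, ‖F x - ∑ j, b j • u j x‖ ^ 2 ∂(wMeasure η Ω)
      = ∫ x, ‖F x‖ ^ 2 ∂(wMeasure η Ω) - ∑ j, b j ^ 2 := by
  have hG : ContDiff ℝ (⊤ : ℕ∞) fun x => ∑ j, b j • u j x :=
    ContDiff.sum fun j _ => (hu j).const_smul _
  have hW : ContDiff ℝ (⊤ : ℕ∞) fun x => F x - ∑ j, b j • u j x := hF.sub hG
  have h1 : ∀ j, ∫ x, ⟪u j x, F x⟫ ∂(wMeasure η Ω) = b j := fun j => by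
    rw [← hb j]
    simp_rw [real_inner_comm (F _)]
  have h2 : ∀ j, ∫ x, ⟪u j x, F x - ∑ j, b j • u j x⟫ ∂(wMeasure η Ω) = 0 := fun j => by
    rw [← integral_inner_sub_projection hη hΩb hu horth hF hb j]
    simp_rw [real_inner_comm (u j _)]
  rw [integral_norm_sub_sq_eq hη hΩb hF hG, integral_inner_sum_smul hη hΩb hu b hF,
    integral_inner_sum_smul hη hΩb hu b hW]
  simp_rw [h1, h2, mul_zero, Finset.sum_const_zero, sub_zero, sq]

/-- The Rayleigh quotient estimate for the component of `F` orthogonal to the given eigenfields. -/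
lemma rayleigh_le_of_projection {T : En n → (En n →L[ℝ] En n)} {α : ℝ}
    (hη : ContDiff ℝ (⊤ : ℕ∞) η) (hΩb : Bornology.IsBounded Ω) (hT : ContDiff ℝ (⊤ : ℕ∞) T)
    (hTsym : ∀ x v w, ⟪T x v, w⟫ = ⟪v, T x w⟫)
    (hu : ∀ i, ContDiff ℝ (⊤ : ℕ∞) (u i)) (hbd : ∀ i, ∀ x ∈ frontier Ω, u i x = 0)
    (horth : ∀ i j, ∫ x, ⟪u i x, u j x⟫ ∂(wMeasure η Ω) = if i = j then 1 else 0)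
    {τ : ι → ℝ} {s : ℝ}
    (hweak : ∀ i, ∀ w : En n → En n, ContDiff ℝ (⊤ : ℕ∞) w → (∀ x ∈ frontier Ω, w x = 0) →
      ∫ x, energyDensity T η α (u i) w x ∂(wMeasure η Ω)
        = τ i * ∫ x, ⟪u i x, w x⟫ ∂(wMeasure η Ω))
    (hmm : ∀ w : En n → En n, ContDiff ℝ (⊤ : ℕ∞) w → (∀ x ∈ frontier Ω, w x = 0) →
      (∀ i, ∫ x, ⟪w x, u i x⟫ ∂(wMeasure η Ω) = 0) →
      s * ∫ x, ‖w x‖ ^ 2 ∂(wMeasure η Ω) ≤ ∫ x, energyDensity T η α w w x ∂(wMeasure η Ω))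
    {F : En n → En n} (hF : ContDiff ℝ (⊤ : ℕ∞) F) (hF0 : ∀ x ∈ frontier Ω, F x = 0)
    {b : ι → ℝ} (hb : ∀ j, ∫ x, ⟪F x, u j x⟫ ∂(wMeasure η Ω) = b j) :
    s * (∫ x, ‖F x‖ ^ 2 ∂(wMeasure η Ω) - ∑ j, b j ^ 2)
      ≤ ∫ x, energyDensity T η α F F x ∂(wMeasure η Ω) - ∑ j, τ j * b j ^ 2 := by
  set G : En n → En n := fun x => ∑ j, b j • u j x with hGdef
  set W : En n → En n := fun x => F x - G x with hWdef
  have hbu : ∀ j, ContDiff ℝ (⊤ : ℕ∞) fun y => b j • u j y := fun j => (hu j).const_smul _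
  have hG : ContDiff ℝ (⊤ : ℕ∞) G := ContDiff.sum fun j _ => hbu j
  have hW : ContDiff ℝ (⊤ : ℕ∞) W := hF.sub hG
  have hW0 : ∀ x ∈ frontier Ω, W x = 0 := fun x hx => by
    simp [hWdef, hGdef, hF0 x hx, fun j => hbd j x hx]
  have hWu : ∀ i, ∫ x, ⟪W x, u i x⟫ ∂(wMeasure η Ω) = 0 :=
    integral_inner_sub_projection hη.continuous hΩb hu horth hF hb
  have hFWG : F = fun y => W y + G y := by funext y; simp [hWdef]
  have hEG : ∀ w : En n → En n, ContDiff ℝ (⊤ : ℕ∞) w → (∀ x ∈ frontier Ω, w x = 0) →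
      ∫ x, energyDensity T η α G w x ∂(wMeasure η Ω)
        = ∑ j, b j * (τ j * ∫ x, ⟪u j x, w x⟫ ∂(wMeasure η Ω)) := by
    intro w hw hw0
    have hpt : ∀ x, energyDensity T η α G w x = ∑ j, b j * energyDensity T η α (u j) w x := by
      intro x
      rw [hGdef, energyDensity_sum_left _ w fun j => (hbu j).differentiable (by simp) x]
      exact Finset.sum_congr rfl fun j _ =>
        energyDensity_const_smul_left _ w ((hu j).differentiable (by simp) x)
    simp_rw [hpt]
    rw [integral_finsetSum _ fun j _ => ((contDiff_energyDensity hT hη (hu j)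
      hw).integrable_wMeasure hη.continuous hΩb).const_mul _]
    simp_rw [integral_const_mul, fun j => hweak j w hw hw0]
  have hpt : ∀ x, energyDensity T η α F F x = energyDensity T η α W W x
      + energyDensity T η α G W x + energyDensity T η α G F x := by
    intro x
    have h : ∀ w, energyDensity T η α F w x
        = energyDensity T η α W w x + energyDensity T η α G w x := fun w => by
      conv_lhs => rw [hFWG]
      exact energyDensity_add_left w (hW.differentiable (by simp) x) (hG.differentiable (by simp) x)
    rw [h F, energyDensity_comm hTsym W F, h W]
  have hI : ∀ {v w : En n → En n}, ContDiff ℝ (⊤ : ℕ∞) v → ContDiff ℝ (⊤ : ℕ∞) w →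
      Integrable (energyDensity T η α v w) (wMeasure η Ω) := fun hv hw =>
    (contDiff_energyDensity hT hη hv hw).integrable_wMeasure hη.continuous hΩb
  have h1 : ∀ j, ∫ x, ⟪u j x, F x⟫ ∂(wMeasure η Ω) = b j := fun j => by
    rw [← hb j]
    simp_rw [real_inner_comm (F _)]
  have h2 : ∀ j, ∫ x, ⟪u j x, W x⟫ ∂(wMeasure η Ω) = 0 := fun j => by
    rw [← hWu j]
    simp_rw [real_inner_comm (u j _)]
  have hE : ∫ x, energyDensity T η α F F x ∂(wMeasure η Ω)
      = ∫ x, energyDensity T η α W W x ∂(wMeasure η Ω) + ∑ j, τ j * b j ^ 2 := by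
    simp_rw [hpt]
    rw [integral_add (f := fun x => energyDensity T η α W W x + energyDensity T η α G W x)
        ((hI hW hW).add (hI hG hW)) (hI hG hF), integral_add (hI hW hW) (hI hG hW),
      hEG W hW hW0, hEG F hF hF0]
    simp only [h1, h2, mul_zero, Finset.sum_const_zero, add_zero]
    congr 1
    exact Finset.sum_congr rfl fun j _ => by ring
  have hnorm := integral_norm_sub_projection_sq hη.continuous hΩb hu horth hF hb
  have := hmm W hW hW0 hWu
  rw [hE]
  change ∫ x, ‖W x‖ ^ 2 ∂(wMeasure η Ω) = _ at hnorm
  rw [hnorm] at this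
  linarith

end Orthonormal

/-- The algebraic core of Yang-type inequalities: the off-diagonal terms form a negative sum of
squares after symmetrization. -/
lemma yang_sum_le {ι : Type*} [Fintype ι] {s m t z Q : ι → ℝ} {a c : ι → ι → ℝ} {B : ℝ}
    (hB : 0 < B) (hs : ∀ i, 0 ≤ s i) (ha : ∀ i j, a i j = a j i) (hc : ∀ i j, c i j = -c j i)
    (h1 : ∀ i, s i * (m i - ∑ j, a i j ^ 2) ≤ Q i + ∑ j, (s j - s i) * a i j ^ 2)
    (h2 : ∀ i r, 0 ≤ r ^ 2 * m i - r * t i + z i - ∑ j, (r * a i j + c i j) ^ 2) :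
    ∑ i, s i ^ 2 * t i ≤ B * ∑ i, s i ^ 2 * Q i + (1 / B) * ∑ i, s i * z i := by
  set R : ι → ι → ℝ := fun i j =>
    B * s i ^ 2 * (s j - s i) * a i j ^ 2 - 2 * s i ^ 2 * (a i j * c i j) - s i / B * c i j ^ 2
    with hR
  have hRle : ∑ i, ∑ j, R i j ≤ 0 := by
    have hpair : ∀ i j, R i j + R j i ≤ 0 := by
      intro i j
      have : R i j + R j i = -((s i + s j) / B * (B * (s i - s j) * a i j + c i j) ^ 2) := by
        simp only [hR]
        rw [ha j i, hc j i]
        field_simp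
        ring
      rw [this]
      have := hs i
      have := hs j
      have : 0 ≤ (s i + s j) / B * (B * (s i - s j) * a i j + c i j) ^ 2 := by positivity
      linarith
    have hsum : ∑ i, ∑ j, (R i j + R j i) ≤ 0 :=
      Finset.sum_nonpos fun i _ => Finset.sum_nonpos fun j _ => hpair i j
    simp only [Finset.sum_add_distrib] at hsum
    rw [Finset.sum_comm (f := fun i j => R j i)] at hsum
    linarith
  have hi : ∀ i, s i ^ 2 * t i ≤ B * (s i ^ 2 * Q i) + 1 / B * (s i * z i) + ∑ j, R i j := by
    intro i
    have e1 := mul_le_mul_of_nonneg_left (h1 i) (show 0 ≤ B * s i ^ 2 by positivity)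
    have e2 := mul_nonneg (div_nonneg (hs i) hB.le) (h2 i (B * s i))
    have hsq : ∑ j, (B * s i * a i j + c i j) ^ 2 = B ^ 2 * s i ^ 2 * ∑ j, a i j ^ 2
        + 2 * B * s i * ∑ j, a i j * c i j + ∑ j, c i j ^ 2 := by
      simp only [Finset.mul_sum, ← Finset.sum_add_distrib]
      exact Finset.sum_congr rfl fun j _ => by ring
    have hRs : ∑ j, R i j = B * s i ^ 2 * ∑ j, (s j - s i) * a i j ^ 2
        - 2 * s i ^ 2 * ∑ j, a i j * c i j - s i / B * ∑ j, c i j ^ 2 := by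
      simp only [hR, Finset.mul_sum, ← Finset.sum_sub_distrib]
      exact Finset.sum_congr rfl fun j _ => by ring
    rw [hsq] at e2
    rw [hRs]
    have e3 : s i / B * ((B * s i) ^ 2 * m i - B * s i * t i + z i
        - (B ^ 2 * s i ^ 2 * ∑ j, a i j ^ 2 + 2 * B * s i * ∑ j, a i j * c i j + ∑ j, c i j ^ 2))
        = B * s i ^ 2 * (s i * (m i - ∑ j, a i j ^ 2)) - s i ^ 2 * t i + 1 / B * (s i * z i)
          - 2 * s i ^ 2 * ∑ j, a i j * c i j - s i / B * ∑ j, c i j ^ 2 := by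
      field_simp
      ring
    rw [e3] at e2
    linarith
  calc ∑ i, s i ^ 2 * t i
      ≤ ∑ i, (B * (s i ^ 2 * Q i) + 1 / B * (s i * z i) + ∑ j, R i j) :=
        Finset.sum_le_sum fun i _ => hi i
    _ = B * ∑ i, s i ^ 2 * Q i + (1 / B) * ∑ i, s i * z i + ∑ i, ∑ j, R i j := by
        simp only [Finset.sum_add_distrib, Finset.mul_sum]
    _ ≤ _ := by linarith

section SkewDerivative

variable {n : ℕ}

/-- The derivative along `Y` corrected by half the weighted divergence of `Y`, which makes it
skew-symmetric in the weighted `L²` space. -/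
def skewDeriv (η : En n → ℝ) (Y u : En n → En n) (x : En n) : En n :=
  fderiv ℝ u x (Y x) + ((1 / 2) * vdivEta η Y x) • u x

variable {η : En n → ℝ} {Y u v : En n → En n} {Ω : Set (En n)}

lemma contDiff_skewDeriv (hη : ContDiff ℝ (⊤ : ℕ∞) η) (hY : ContDiff ℝ (⊤ : ℕ∞) Y)
    (hu : ContDiff ℝ (⊤ : ℕ∞) u) : ContDiff ℝ (⊤ : ℕ∞) (skewDeriv η Y u) :=
  ((hu.fderiv_right (m := (⊤ : ℕ∞)) (by simp)).clm_apply hY).add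
    ((contDiff_const.mul (contDiff_vdivEta hη hY)).smul hu)

lemma integral_mul_inner_skewDeriv (hΩ : IsOpen Ω) (hΩb : Bornology.IsBounded Ω)
    (hη : ContDiff ℝ (⊤ : ℕ∞) η) (hY : ContDiff ℝ (⊤ : ℕ∞) Y) {f : En n → ℝ}
    (hf : ContDiff ℝ (⊤ : ℕ∞) f) (hu : ContDiff ℝ (⊤ : ℕ∞) u) (hv : ContDiff ℝ (⊤ : ℕ∞) v)
    (hu0 : ∀ x ∈ frontier Ω, u x = 0) :
    ∫ x, f x * ⟪skewDeriv η Y u x, v x⟫ ∂(wMeasure η Ω)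
      + ∫ x, f x * ⟪u x, skewDeriv η Y v x⟫ ∂(wMeasure η Ω)
      + ∫ x, ⟪u x, v x⟫ * ⟪gradient f x, Y x⟫ ∂(wMeasure η Ω) = 0 := by
  have hg : ContDiff ℝ (⊤ : ℕ∞) fun y => f y * ⟪u y, v y⟫ := hf.mul (hu.inner ℝ hv)
  have h := integral_mul_vdivEta hΩ hΩb hη hg hY (fun x hx => by simp [hu0 x hx])
  have hi1 := (hf.mul ((contDiff_skewDeriv hη hY hu).inner ℝ hv)).integrable_wMeasure
    hη.continuous hΩb
  have hi2 := (hf.mul (hu.inner ℝ (contDiff_skewDeriv hη hY hv))).integrable_wMeasure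
    hη.continuous hΩb
  have hi3 := ((hu.inner ℝ hv).mul ((contDiff_gradient hf).inner ℝ hY)).integrable_wMeasure
    hη.continuous hΩb
  have e1 := integral_add (hi1.add hi2) hi3
  have e2 := integral_add hi1 hi2
  simp only [Pi.add_apply] at e1
  rw [← e2, ← e1, ← h]
  refine integral_congr_ae (Filter.Eventually.of_forall fun x => ?_)
  have hud : DifferentiableAt ℝ u x := hu.differentiable (by simp) x
  have hvd : DifferentiableAt ℝ v x := hv.differentiable (by simp) x
  have hfd : DifferentiableAt ℝ f x := hf.differentiable (by simp) x
  have hgr : ⟪gradient (fun y => f y * ⟪u y, v y⟫) x, Y x⟫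
      = f x * (⟪u x, fderiv ℝ v x (Y x)⟫ + ⟪fderiv ℝ u x (Y x), v x⟫)
        + ⟪u x, v x⟫ * ⟪gradient f x, Y x⟫ := by
    rw [gradient_mul_fun hfd (hud.inner ℝ hvd), inner_add_left, inner_smul_left, inner_smul_left,
      inner_gradient_left (f := fun y => ⟪u y, v y⟫), fderiv_inner_apply ℝ hud hvd]
    simp
  simp only [hgr, skewDeriv, inner_add_left, inner_add_right, inner_smul_left, inner_smul_right,
    conj_trivial]
  ring

end SkewDerivative

section CoordinateFields

variable {n : ℕ} {T : En n → (En n →L[ℝ] En n)} {η : En n → ℝ}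

lemma vdivEta_apply_single (hT : Differentiable ℝ T)
    (hTsym : ∀ x v w, ⟪T x v, w⟫ = ⟪v, T x w⟫) (p : Fin n) (x : En n) :
    vdivEta η (fun y => T y (EuclideanSpace.single p 1)) x
      = (trGradT T x - T x (gradient η x)) p := by
  have hfd : ∀ a w : En n, fderiv ℝ (fun y => T y a) x w = fderiv ℝ T x w a := fun a w => by
    have h := (hT x).hasFDerivAt.clm_apply (hasFDerivAt_const a x)
    rw [h.fderiv]
    simp
  have hsym : ∀ a b w : En n, ⟪fderiv ℝ T x w a, b⟫ = ⟪a, fderiv ℝ T x w b⟫ := fun a b w => by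
    have hd : ∀ c : En n, DifferentiableAt ℝ (fun y => T y c) x := fun c =>
      (hT x).clm_apply (differentiableAt_const c)
    have h1 := fderiv_inner_apply ℝ (hd a) (differentiableAt_const b) w
    have h2 := fderiv_inner_apply ℝ (differentiableAt_const a) (hd b) w
    simp only [hTsym] at h1
    rw [h1] at h2
    simpa [hfd] using h2
  have hcoord : ∀ (a : En n) (i : Fin n), a i = ⟪a, EuclideanSpace.single i (1 : ℝ)⟫ :=
    fun a i => by rw [EuclideanSpace.inner_single_right]; simp
  have h1 : vdiv (fun y => T y (EuclideanSpace.single p 1)) x = trGradT T x p := by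
    rw [hcoord (trGradT T x) p, vdiv, trGradT, sum_inner]
    refine Finset.sum_congr rfl fun i _ => ?_
    rw [hfd, hcoord, hsym, real_inner_comm]
  rw [vdivEta, h1, PiLp.sub_apply, hcoord (T x (gradient η x)), hTsym]

/-- Summing the squares of the skew derivatives along `T e₁, …, T eₙ`. -/
lemma sum_norm_skewDeriv_sq (hT : Differentiable ℝ T)
    (hTsym : ∀ x v w, ⟪T x v, w⟫ = ⟪v, T x w⟫) {u : En n → En n} {x : En n}
    (hu : DifferentiableAt ℝ u x) :
    ∑ p, ‖skewDeriv η (fun y => T y (EuclideanSpace.single p 1)) u x‖ ^ 2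
      = ∑ l, ‖T x (gradient (fun y => u y l) x)
          + ((1 / 2) * u x l) • (trGradT T x - T x (gradient η x))‖ ^ 2 := by
  have hn : ∀ a : En n, ‖a‖ ^ 2 = ∑ i, a i ^ 2 := fun a => by
    rw [← real_inner_self_eq_norm_sq, PiLp.inner_apply]
    simp [sq]
  have hpl : ∀ p l : Fin n, skewDeriv η (fun y => T y (EuclideanSpace.single p 1)) u x l
      = (T x (gradient (fun y => u y l) x)
          + ((1 / 2) * u x l) • (trGradT T x - T x (gradient η x))) p := fun p l => by
    have h1 : T x (gradient (fun y => u y l) x) p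
        = fderiv ℝ u x (T x (EuclideanSpace.single p 1)) l := by
      have : T x (gradient (fun y => u y l) x) p
          = ⟪T x (gradient (fun y => u y l) x), EuclideanSpace.single p (1 : ℝ)⟫ := by
        rw [EuclideanSpace.inner_single_right]; simp
      rw [this, hTsym, inner_gradient_left, fderiv_coord hu]
    rw [skewDeriv, vdivEta_apply_single hT hTsym]
    simp only [PiLp.add_apply, PiLp.smul_apply, smul_eq_mul, h1]
    ring
  simp_rw [hn, hpl]
  exact Finset.sum_comm

lemma norm_apply_sq_le {A : En n →L[ℝ] En n} {δ : ℝ} (hA : ∀ v w, ⟪A v, w⟫ = ⟪v, A w⟫)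
    (hpos : ∀ v, 0 ≤ ⟪A v, v⟫) (hle : ∀ v, ⟪A v, v⟫ ≤ δ * ‖v‖ ^ 2) (v : En n) :
    ‖A v‖ ^ 2 ≤ δ * ⟪A v, v⟫ := by
  have hquad : ∀ r : ℝ, 0 ≤ ⟪A v, v⟫ - 2 * r * ‖A v‖ ^ 2 + r ^ 2 * ⟪A (A v), A v⟫ := fun r => by
    have h := hpos (v - r • A v)
    have hs : ⟪A (A v), v⟫ = ‖A v‖ ^ 2 := by rw [hA, real_inner_self_eq_norm_sq]
    simp only [map_sub, map_smul, inner_sub_left, inner_sub_right, inner_smul_left,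
      inner_smul_right, conj_trivial, hs, real_inner_self_eq_norm_sq] at h
    linarith
  rcases eq_or_ne (A v) 0 with h0 | h0
  · simp [h0]
  have hN : 0 < ‖A v‖ ^ 2 := by positivity
  have hδ : 0 ≤ δ := by
    by_contra! h
    have := (hpos (A v)).trans (hle (A v))
    nlinarith
  rcases hδ.eq_or_lt with h | h
  · have h1 := hle v
    have h2 := hpos v
    have h3 := hquad 1
    have h4 := hle (A v)
    rw [← h] at h1 h4 ⊢
    nlinarith
  · have h1 := hquad (1 / δ)
    have h4 := mul_le_mul_of_nonneg_left (hle (A v)) (show 0 ≤ (1 / δ) ^ 2 by positivity)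
    have h5 : (1 / δ) ^ 2 * (δ * ‖A v‖ ^ 2) = 1 / δ * ‖A v‖ ^ 2 := by field_simp
    have h6 : 0 ≤ ⟪A v, v⟫ - 1 / δ * ‖A v‖ ^ 2 := by linarith
    have h7 := mul_nonneg h.le h6
    have h8 : δ * (⟪A v, v⟫ - 1 / δ * ‖A v‖ ^ 2) = δ * ⟪A v, v⟫ - ‖A v‖ ^ 2 := by field_simp
    linarith

lemma bddAbove_image_of_continuous {Ω : Set (En n)} (hΩb : Bornology.IsBounded Ω) {f : En n → ℝ}
    (hf : Continuous f) : BddAbove (f '' Ω) :=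
  (hΩb.isCompact_closure.image hf).bddAbove.mono (Set.image_mono subset_closure)

/-- The total `L²` bound on the skew derivatives along `T e₁, …, T eₙ`. -/
lemma sum_integral_norm_skewDeriv_sq_le {Ω : Set (En n)} (hΩ : IsOpen Ω)
    (hΩb : Bornology.IsBounded Ω) (hη : ContDiff ℝ (⊤ : ℕ∞) η) (hT : ContDiff ℝ (⊤ : ℕ∞) T)
    (hTsym : ∀ x v w, ⟪T x v, w⟫ = ⟪v, T x w⟫) {δ : ℝ} (hpos : ∀ x v, 0 ≤ ⟪T x v, v⟫)
    (hle : ∀ x v, ⟪T x v, v⟫ ≤ δ * ‖v‖ ^ 2) {T₀ C₀ : ℝ}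
    (hT₀ : ∀ x ∈ Ω, ‖trGradT T x‖ ≤ T₀)
    (hC₀ : ∀ x ∈ Ω, (1 / 2) * vdiv (fun y => T y (T y (gradient η y) - trGradT T y)) x
      - (1 / 4) * ‖T x (gradient η x)‖ ^ 2 ≤ C₀)
    {u : En n → En n} (hu : ContDiff ℝ (⊤ : ℕ∞) u) (hu0 : ∀ x ∈ frontier Ω, u x = 0) :
    ∑ p, ∫ x, ‖skewDeriv η (fun y => T y (EuclideanSpace.single p 1)) u x‖ ^ 2 ∂(wMeasure η Ω)
      ≤ δ * ∫ x, (∑ l, ⟪T x (gradient (fun y => u y l) x), gradient (fun y => u y l) x⟫)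
          ∂(wMeasure η Ω)
        + (C₀ + T₀ ^ 2 / 4) * ∫ x, ‖u x‖ ^ 2 ∂(wMeasure η Ω) := by
  set V : En n → En n := fun y => T y (gradient η y) - trGradT T y with hVdef
  have hV : ContDiff ℝ (⊤ : ℕ∞) V := (hT.clm_apply (contDiff_gradient hη)).sub (contDiff_trGradT hT)
  have hTV : ContDiff ℝ (⊤ : ℕ∞) fun y => T y (V y) := hT.clm_apply hV
  have hN : ContDiff ℝ (⊤ : ℕ∞) fun y => ‖u y‖ ^ 2 := hu.norm_sq ℝ
  have hYp : ∀ p : Fin n, ContDiff ℝ (⊤ : ℕ∞) fun y => T y (EuclideanSpace.single p (1 : ℝ)) :=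
    fun p => hT.clm_apply contDiff_const
  have hZ : ∀ p : Fin n, ContDiff ℝ (⊤ : ℕ∞) fun x =>
      ‖skewDeriv η (fun y => T y (EuclideanSpace.single p 1)) u x‖ ^ 2 :=
    fun p => (contDiff_skewDeriv hη (hYp p) hu).norm_sq ℝ
  have hgl : ∀ l : Fin n, ContDiff ℝ (⊤ : ℕ∞) fun x => gradient (fun y => u y l) x :=
    fun l => contDiff_gradient (contDiff_coord hu l)
  have hE : ContDiff ℝ (⊤ : ℕ∞) fun x =>
      ∑ l, ⟪T x (gradient (fun y => u y l) x), gradient (fun y => u y l) x⟫ :=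
    ContDiff.sum fun l _ => (hT.clm_apply (hgl l)).inner ℝ (hgl l)
  have hD : ContDiff ℝ (⊤ : ℕ∞) fun x => ‖u x‖ ^ 2 * vdivEta η (fun y => T y (V y)) x
      + ⟪gradient (fun y => ‖u y‖ ^ 2) x, T x (V x)⟫ :=
    (hN.mul (contDiff_vdivEta hη hTV)).add ((contDiff_gradient hN).inner ℝ hTV)
  have hibp := integral_mul_vdivEta hΩ hΩb hη hN hTV (fun x hx => by simp [hu0 x hx])
  have hn : ∀ x, ‖u x‖ ^ 2 = ∑ l, u x l * u x l := fun x => by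
    rw [← real_inner_self_eq_norm_sq, PiLp.inner_apply]
    simp [sq]
  have hgN : ∀ x, gradient (fun y => ‖u y‖ ^ 2) x
      = ∑ l, (2 * u x l) • gradient (fun y => u y l) x := fun x => by
    have hd : ∀ l : Fin n, DifferentiableAt ℝ (fun y => u y l) x := fun l =>
      (contDiff_coord hu l).differentiable (by simp) x
    have h := gradient_sum_const_mul Finset.univ (fun _ : Fin n => (1 : ℝ))
      (g := fun l y => u y l * u y l) (x := x) fun l _ => (hd l).mul (hd l)
    simp only [one_mul, one_smul] at h
    simp_rw [hn]
    rw [h]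
    refine Finset.sum_congr rfl fun l _ => ?_
    rw [gradient_mul_fun (hd l) (hd l), two_mul, add_smul]
  have hpt : ∀ x ∈ Ω, ∑ p, ‖skewDeriv η (fun y => T y (EuclideanSpace.single p 1)) u x‖ ^ 2
      ≤ δ * (∑ l, ⟪T x (gradient (fun y => u y l) x), gradient (fun y => u y l) x⟫)
        + (C₀ + T₀ ^ 2 / 4) * ‖u x‖ ^ 2
        - (1 / 2) * (‖u x‖ ^ 2 * vdivEta η (fun y => T y (V y)) x
          + ⟪gradient (fun y => ‖u y‖ ^ 2) x, T x (V x)⟫) := by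
    intro x hx
    rw [sum_norm_skewDeriv_sq (hT.differentiable (by simp)) hTsym (hu.differentiable (by simp) x)]
    have hVneg : trGradT T x - T x (gradient η x) = -V x := by simp [hVdef]
    have h1 : ∀ l : Fin n, ‖T x (gradient (fun y => u y l) x)
          + ((1 / 2) * u x l) • (trGradT T x - T x (gradient η x))‖ ^ 2
        ≤ δ * ⟪T x (gradient (fun y => u y l) x), gradient (fun y => u y l) x⟫
          - (1 / 2) * ⟪(2 * u x l) • gradient (fun y => u y l) x, T x (V x)⟫
          + 1 / 4 * ‖V x‖ ^ 2 * (u x l * u x l) := fun l => by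
      have := norm_apply_sq_le (hTsym x) (hpos x) (hle x) (gradient (fun y => u y l) x)
      rw [hVneg, norm_add_sq_real, norm_smul, norm_neg, mul_pow, inner_smul_right, inner_neg_right,
        inner_smul_left, ← hTsym, Real.norm_eq_abs, sq_abs]
      simp only [conj_trivial]
      linarith
    refine (Finset.sum_le_sum fun l _ => h1 l).trans ?_
    rw [Finset.sum_add_distrib, Finset.sum_sub_distrib, ← Finset.mul_sum, ← Finset.mul_sum,
      ← Finset.mul_sum, ← hn, ← sum_inner, ← hgN]
    have h2 : vdivEta η (fun y => T y (V y)) x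
        = vdiv (fun y => T y (V y)) x - ⟪T x (gradient η x), V x⟫ := by
      rw [vdivEta, hTsym]
    have h3 : ‖V x‖ ^ 2 = 2 * ⟪T x (gradient η x), V x⟫ - ‖T x (gradient η x)‖ ^ 2
        + ‖trGradT T x‖ ^ 2 := by
      simp only [hVdef, norm_sub_sq_real, inner_sub_right, real_inner_self_eq_norm_sq]
      ring
    have h4 : ‖trGradT T x‖ ^ 2 ≤ T₀ ^ 2 := pow_le_pow_left₀ (norm_nonneg _) (hT₀ x hx) 2
    have h5 := hC₀ x hx
    have h6 : 1 / 4 * ‖V x‖ ^ 2 ≤ C₀ + T₀ ^ 2 / 4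
        - (1 / 2) * vdivEta η (fun y => T y (V y)) x := by
      rw [h2, h3]; linarith
    have h7 := mul_le_mul_of_nonneg_right h6 (sq_nonneg ‖u x‖)
    linarith
  have hI : ∀ {g : En n → ℝ}, ContDiff ℝ (⊤ : ℕ∞) g → Integrable g (wMeasure η Ω) :=
    fun hg => hg.integrable_wMeasure hη.continuous hΩb
  rw [← integral_finsetSum _ fun p _ => hI (hZ p)]
  have hi1 := (hI hE).const_mul δ
  have hi2 := (hI hN).const_mul (C₀ + T₀ ^ 2 / 4)
  have hi3 := (hI hD).const_mul (1 / 2)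
  have e1 := integral_sub (hi1.add hi2) hi3
  have e2 := integral_add hi1 hi2
  simp only [Pi.add_apply] at e1
  have hmono := integral_mono_ae (integrable_finsetSum _ fun p _ => hI (hZ p))
    ((hi1.add hi2).sub hi3) ((ae_wMeasure_mem hΩ).mono hpt)
  simp only [Pi.add_apply, Pi.sub_apply] at hmono
  rw [e1, e2] at hmono
  simp only [integral_const_mul] at hmono
  rw [hibp] at hmono
  linarith

end CoordinateFields

section Yang

variable {n : ℕ} {η : En n → ℝ} {Ω : Set (En n)} {T : En n → (En n →L[ℝ] En n)} {α : ℝ}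
  {ι : Type*} [Fintype ι] [DecidableEq ι] {u : ι → En n → En n}

/-- The commutator estimate for a test function `f` and a vector field `Y`. -/
lemma sum_sq_mul_integral_gradient_le (hΩ : IsOpen Ω) (hΩb : Bornology.IsBounded Ω)
    (hη : ContDiff ℝ (⊤ : ℕ∞) η) (hT : ContDiff ℝ (⊤ : ℕ∞) T)
    (hTsym : ∀ x v w, ⟪T x v, w⟫ = ⟪v, T x w⟫)
    (hu : ∀ i, ContDiff ℝ (⊤ : ℕ∞) (u i)) (hbd : ∀ i, ∀ x ∈ frontier Ω, u i x = 0)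
    (horth : ∀ i j, ∫ x, ⟪u i x, u j x⟫ ∂(wMeasure η Ω) = if i = j then 1 else 0)
    {τ : ι → ℝ} {s : ℝ} (hs : ∀ i, τ i ≤ s)
    (hweak : ∀ i, ∀ w : En n → En n, ContDiff ℝ (⊤ : ℕ∞) w → (∀ x ∈ frontier Ω, w x = 0) →
      ∫ x, energyDensity T η α (u i) w x ∂(wMeasure η Ω)
        = τ i * ∫ x, ⟪u i x, w x⟫ ∂(wMeasure η Ω))
    (hmm : ∀ w : En n → En n, ContDiff ℝ (⊤ : ℕ∞) w → (∀ x ∈ frontier Ω, w x = 0) →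
      (∀ i, ∫ x, ⟪w x, u i x⟫ ∂(wMeasure η Ω) = 0) →
      s * ∫ x, ‖w x‖ ^ 2 ∂(wMeasure η Ω) ≤ ∫ x, energyDensity T η α w w x ∂(wMeasure η Ω))
    {f : En n → ℝ} (hf : ContDiff ℝ (⊤ : ℕ∞) f) {Y : En n → En n} (hY : ContDiff ℝ (⊤ : ℕ∞) Y)
    {B : ℝ} (hB : 0 < B) :
    ∑ i, (s - τ i) ^ 2 * ∫ x, ‖u i x‖ ^ 2 * ⟪gradient f x, Y x⟫ ∂(wMeasure η Ω)
      ≤ B * ∑ i, (s - τ i) ^ 2 * ∫ x, (‖u i x‖ ^ 2 * ⟪T x (gradient f x), gradient f x⟫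
          + α * ⟪gradient f x, u i x⟫ ^ 2) ∂(wMeasure η Ω)
        + (1 / B) * ∑ i, (s - τ i) * ∫ x, ‖skewDeriv η Y (u i) x‖ ^ 2 ∂(wMeasure η Ω) := by
  have hgf := contDiff_gradient hf
  have hF : ∀ i, ContDiff ℝ (⊤ : ℕ∞) fun x => f x • u i x := fun i => hf.smul (hu i)
  have hZ : ∀ i, ContDiff ℝ (⊤ : ℕ∞) (skewDeriv η Y (u i)) := fun i =>
    contDiff_skewDeriv hη hY (hu i)
  refine yang_sum_le (m := fun i => ∫ x, ‖f x • u i x‖ ^ 2 ∂(wMeasure η Ω))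
    (a := fun i j => ∫ x, ⟪f x • u i x, u j x⟫ ∂(wMeasure η Ω))
    (c := fun i j => ∫ x, ⟪skewDeriv η Y (u i) x, u j x⟫ ∂(wMeasure η Ω))
    hB (fun i => sub_nonneg.2 (hs i)) (fun i j => ?_) (fun i j => ?_) (fun i => ?_)
    (fun i r => ?_)
  · refine integral_congr_ae (Filter.Eventually.of_forall fun x => ?_)
    simp only [real_inner_smul_left]
    rw [real_inner_comm]
  · have h := integral_mul_inner_skewDeriv hΩ hΩb hη hY
      (contDiff_const (c := (1 : ℝ))) (hu i) (hu j) (hbd i)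
    have hg : ∀ x, gradient (fun _ : En n => (1 : ℝ)) x = 0 := fun x => by
      simp [gradient]
    simp only [one_mul, hg, inner_zero_left, mul_zero, integral_zero, add_zero] at h
    have e : ∫ x, ⟪skewDeriv η Y (u j) x, u i x⟫ ∂(wMeasure η Ω)
        = ∫ x, ⟪u i x, skewDeriv η Y (u j) x⟫ ∂(wMeasure η Ω) :=
      integral_congr_ae (Filter.Eventually.of_forall fun x => real_inner_comm _ _)
    simp only [e]
    linarith
  · have hF0 : ∀ x ∈ frontier Ω, f x • u i x = 0 := fun x hx => by simp [hbd i x hx]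
    have hray := rayleigh_le_of_projection hη hΩb hT hTsym hu hbd horth hweak hmm (hF i) hF0
      (fun _ => rfl)
    have hG : ContDiff ℝ (⊤ : ℕ∞) fun y => (f y * f y) • u i y := (hf.mul hf).smul (hu i)
    have hQ : ContDiff ℝ (⊤ : ℕ∞) fun x => ‖u i x‖ ^ 2 * ⟪T x (gradient f x), gradient f x⟫
        + α * ⟪gradient f x, u i x⟫ ^ 2 :=
      (((hu i).norm_sq ℝ).mul ((hT.clm_apply hgf).inner ℝ hgf)).add
        (contDiff_const.mul ((hgf.inner ℝ (hu i)).pow 2))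
    have hadd := integral_add
      (ContDiff.integrable_wMeasure hη.continuous hΩb
        (contDiff_energyDensity (α := α) hT hη (hu i) hG))
      (ContDiff.integrable_wMeasure hη.continuous hΩb hQ)
    rw [hweak i _ hG fun x hx => by simp [hbd i x hx]] at hadd
    have hE : ∫ x, energyDensity T η α (fun y => f y • u i y) (fun y => f y • u i y) x
          ∂(wMeasure η Ω)
        = ∫ x, (energyDensity T η α (u i) (fun y => (f y * f y) • u i y) x
          + (‖u i x‖ ^ 2 * ⟪T x (gradient f x), gradient f x⟫
            + α * ⟪gradient f x, u i x⟫ ^ 2)) ∂(wMeasure η Ω) :=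
      integral_congr_ae (Filter.Eventually.of_forall fun x => energyDensity_smul_smul hTsym
        (hf.differentiable (by simp) x) ((hu i).differentiable (by simp) x))
    have hm : ∫ x, ⟪u i x, (f x * f x) • u i x⟫ ∂(wMeasure η Ω)
        = ∫ x, ‖f x • u i x‖ ^ 2 ∂(wMeasure η Ω) :=
      integral_congr_ae (Filter.Eventually.of_forall fun x => by
        simp only [← real_inner_self_eq_norm_sq, real_inner_smul_left, real_inner_smul_right]
        ring)
    rw [hE, hadd, hm] at hray
    have hsum : ∀ a : ι → ℝ, ∑ j, (s - τ j - (s - τ i)) * a j ^ 2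
        = τ i * ∑ j, a j ^ 2 - ∑ j, τ j * a j ^ 2 := fun a => by
      rw [Finset.mul_sum, ← Finset.sum_sub_distrib]
      exact Finset.sum_congr rfl fun j _ => by ring
    rw [hsum]
    linarith
  · have hFr : ContDiff ℝ (⊤ : ℕ∞) fun x => r • (f x • u i x) + skewDeriv η Y (u i) x :=
      ((hF i).const_smul r).add (hZ i)
    have hb : ∀ j, ∫ x, ⟪r • (f x • u i x) + skewDeriv η Y (u i) x, u j x⟫ ∂(wMeasure η Ω)
        = r * ∫ x, ⟪f x • u i x, u j x⟫ ∂(wMeasure η Ω)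
          + ∫ x, ⟪skewDeriv η Y (u i) x, u j x⟫ ∂(wMeasure η Ω) := fun j => by
      have h := integral_add
        ((ContDiff.integrable_wMeasure hη.continuous hΩb ((hF i).inner ℝ (hu j))).const_mul r)
        (ContDiff.integrable_wMeasure hη.continuous hΩb ((hZ i).inner ℝ (hu j)))
      rw [integral_const_mul] at h
      rw [← h]
      refine integral_congr_ae (Filter.Eventually.of_forall fun x => ?_)
      simp only [inner_add_left, real_inner_smul_left]
    have hproj := integral_norm_sub_projection_sq hη.continuous hΩb hu horth hFr hb
    have hnn : 0 ≤ ∫ x, ‖(r • (f x • u i x) + skewDeriv η Y (u i) x) - ∑ j,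
        (r * ∫ x, ⟪f x • u i x, u j x⟫ ∂(wMeasure η Ω)
          + ∫ x, ⟪skewDeriv η Y (u i) x, u j x⟫ ∂(wMeasure η Ω)) • u j x‖ ^ 2
          ∂(wMeasure η Ω) :=
      integral_nonneg fun x => sq_nonneg _
    have hskew := integral_mul_inner_skewDeriv hΩ hΩb hη hY hf (hu i) (hu i) (hbd i)
    have e1 : ∫ x, f x * ⟪skewDeriv η Y (u i) x, u i x⟫ ∂(wMeasure η Ω)
        = ∫ x, f x * ⟪u i x, skewDeriv η Y (u i) x⟫ ∂(wMeasure η Ω) :=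
      integral_congr_ae (Filter.Eventually.of_forall fun x => by
        simp only [real_inner_comm])
    have e2 : ∫ x, ⟪u i x, u i x⟫ * ⟪gradient f x, Y x⟫ ∂(wMeasure η Ω)
        = ∫ x, ‖u i x‖ ^ 2 * ⟪gradient f x, Y x⟫ ∂(wMeasure η Ω) :=
      integral_congr_ae (Filter.Eventually.of_forall fun x => by
        simp only [real_inner_self_eq_norm_sq])
    have hi1 := (ContDiff.integrable_wMeasure (Ω := Ω) hη.continuous hΩb
      ((hF i).norm_sq ℝ)).const_mul (r ^ 2)
    have hi2 := (ContDiff.integrable_wMeasure (Ω := Ω) hη.continuous hΩb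
      (hf.mul ((hu i).inner ℝ (hZ i)))).const_mul (2 * r)
    have hi3 := ContDiff.integrable_wMeasure (Ω := Ω) hη.continuous hΩb ((hZ i).norm_sq ℝ)
    have e3 := integral_add (hi1.add hi2) hi3
    have e4 := integral_add hi1 hi2
    simp only [Pi.add_apply] at e3
    rw [e4, integral_const_mul, integral_const_mul] at e3
    have e5 : ∫ x, ‖r • (f x • u i x) + skewDeriv η Y (u i) x‖ ^ 2 ∂(wMeasure η Ω)
        = ∫ x, (r ^ 2 * ‖f x • u i x‖ ^ 2 + 2 * r * (f x * ⟪u i x, skewDeriv η Y (u i) x⟫)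
          + ‖skewDeriv η Y (u i) x‖ ^ 2) ∂(wMeasure η Ω) := by
      refine integral_congr_ae (Filter.Eventually.of_forall fun x => ?_)
      simp only [norm_add_sq_real, real_inner_smul_left, norm_smul r, mul_pow,
        Real.norm_eq_abs, sq_abs]
      ring
    rw [e5, e3] at hproj
    rw [hproj] at hnn
    rw [e1, e2] at hskew
    have hr : r * ∫ x, ‖u i x‖ ^ 2 * ⟪gradient f x, Y x⟫ ∂(wMeasure η Ω)
        = -(2 * r * ∫ x, f x * ⟪u i x, skewDeriv η Y (u i) x⟫ ∂(wMeasure η Ω)) := by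
      linear_combination r * hskew
    linarith

end Yang

/-- Theorem 1.1: quadratic (Yang-type) estimate for the eigenvalues of the coupled
system `𝓛 u + α ∇(div_η u) = −σ u` on a bounded domain `Ω ⊂ ℝⁿ`. -/
theorem yang_type_estimate_second_order_system
    (n : ℕ) (hn : 1 ≤ n)
    (Ω : Set (En n)) (hΩopen : IsOpen Ω) (hΩbd : Bornology.IsBounded Ω)
    (hΩconn : IsConnected Ω)
    (η : En n → ℝ) (hη : ContDiff ℝ (⊤ : ℕ∞) η)
    (T : En n → (En n →L[ℝ] En n)) (hT : ContDiff ℝ (⊤ : ℕ∞) T)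
    (hTsym : ∀ x v w, ⟪T x v, w⟫ = ⟪v, T x w⟫)
    (ε δ : ℝ) (hε : 0 < ε) (hεδ : ε ≤ δ)
    (hell : ∀ x v, ε * ‖v‖ ^ 2 ≤ ⟪T x v, v⟫ ∧ ⟪T x v, v⟫ ≤ δ * ‖v‖ ^ 2)
    (T₀ C₀ : ℝ)
    (hT₀ : T₀ = sSup ((fun x => ‖trGradT T x‖) '' Ω))
    (hC₀ : C₀ = sSup ((fun x =>
        (1 / 2) * vdiv (fun y => T y (T y (gradient η y) - trGradT T y)) x
          - (1 / 4) * ‖T x (gradient η x)‖ ^ 2) '' Ω))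
    (α : ℝ) (hα : 0 ≤ α)
    (k : ℕ) (hk : 1 ≤ k)
    (σ : Fin (k + 1) → ℝ) (hσ : Monotone σ)
    (u : Fin k → En n → En n) (hu : ∀ i, ContDiff ℝ (⊤ : ℕ∞) (u i))
    (hbd : ∀ i, ∀ x ∈ frontier Ω, u i x = 0)
    (horth : ∀ i j, ∫ x, ⟪u i x, u j x⟫ ∂(wMeasure η Ω) = if i = j then 1 else 0)
    (heig : ∀ (i : Fin k), ∀ x ∈ Ω, ∀ l : Fin n,
      Lop T η (fun y => u i y l) x + α * gradient (vdivEta η (u i)) x l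
        = -(σ i.castSucc) * u i x l)
    (hmm : ∀ w : En n → En n, ContDiff ℝ (⊤ : ℕ∞) w → (∀ x ∈ frontier Ω, w x = 0) →
      (∀ i : Fin k, ∫ x, ⟪w x, u i x⟫ ∂(wMeasure η Ω) = 0) →
      σ (Fin.last k) * ∫ x, ‖w x‖ ^ 2 ∂(wMeasure η Ω) ≤
        ∫ x, ((∑ l, ⟪T x (gradient (fun y => w y l) x), gradient (fun y => w y l) x⟫)
          + α * (vdivEta η w x) ^ 2) ∂(wMeasure η Ω)) :
    ∑ i : Fin k, (σ (Fin.last k) - σ i.castSucc) ^ 2 ≤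
      (4 * δ * (n * δ + α) / (n ^ 2 * ε ^ 2)) *
        ∑ i : Fin k, (σ (Fin.last k) - σ i.castSucc) *
          (σ i.castSucc - α * (∫ x, (vdivEta η (u i) x) ^ 2 ∂(wMeasure η Ω))
            + (T₀ ^ 2 + 4 * C₀) / (4 * δ)) := by
  have hμ : ∀ {g : En n → ℝ}, ContDiff ℝ (⊤ : ℕ∞) g → Integrable g (wMeasure η Ω) :=
    fun hg => ContDiff.integrable_wMeasure hη.continuous hΩbd hg
  have hδ : 0 < δ := hε.trans_le hεδ
  have hn0 : (0 : ℝ) < n := by exact_mod_cast hn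
  have hD : 0 < n * δ + α := by positivity
  have hs : ∀ i : Fin k, σ i.castSucc ≤ σ (Fin.last k) := fun i => hσ (Fin.le_last _)
  have hweak : ∀ i, ∀ w : En n → En n, ContDiff ℝ (⊤ : ℕ∞) w → (∀ x ∈ frontier Ω, w x = 0) →
      ∫ x, energyDensity T η α (u i) w x ∂(wMeasure η Ω)
        = σ i.castSucc * ∫ x, ⟪u i x, w x⟫ ∂(wMeasure η Ω) := fun i w hw hw0 =>
    integral_energyDensity_eq hΩopen hΩbd hη hT (hu i) hw hw0 (heig i)
  have hmm' : ∀ w : En n → En n, ContDiff ℝ (⊤ : ℕ∞) w → (∀ x ∈ frontier Ω, w x = 0) →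
      (∀ i : Fin k, ∫ x, ⟪w x, u i x⟫ ∂(wMeasure η Ω) = 0) →
      σ (Fin.last k) * ∫ x, ‖w x‖ ^ 2 ∂(wMeasure η Ω)
        ≤ ∫ x, energyDensity T η α w w x ∂(wMeasure η Ω) := fun w hw hw0 hwu => by
    simpa only [energyDensity, sq] using hmm w hw hw0 hwu
  have hnorm : ∀ i, ∫ x, ‖u i x‖ ^ 2 ∂(wMeasure η Ω) = 1 := fun i => by
    simpa [real_inner_self_eq_norm_sq] using horth i i
  have hgη := contDiff_gradient hη
  have hT₀' : ∀ x ∈ Ω, ‖trGradT T x‖ ≤ T₀ := fun x hx => hT₀ ▸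
    le_csSup (bddAbove_image_of_continuous hΩbd (contDiff_trGradT hT).continuous.norm)
      (Set.mem_image_of_mem _ hx)
  have hC₀' : ∀ x ∈ Ω, (1 / 2) * vdiv (fun y => T y (T y (gradient η y) - trGradT T y)) x
      - (1 / 4) * ‖T x (gradient η x)‖ ^ 2 ≤ C₀ := fun x hx => hC₀ ▸
    le_csSup (bddAbove_image_of_continuous hΩbd
      (((contDiff_vdiv (hT.clm_apply
        ((hT.clm_apply hgη).sub (contDiff_trGradT hT)))).continuous.const_mul _).sub
        (((hT.clm_apply hgη).continuous.norm.pow 2).const_mul _)))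
      (Set.mem_image_of_mem (fun x =>
        (1 / 2) * vdiv (fun y => T y (T y (gradient η y) - trGradT T y)) x
          - (1 / 4) * ‖T x (gradient η x)‖ ^ 2) hx)
  have hpos : ∀ x v, 0 ≤ ⟪T x v, v⟫ := fun x v =>
    (mul_nonneg hε.le (sq_nonneg _)).trans (hell x v).1
  have hY : ∀ p : Fin n, ContDiff ℝ (⊤ : ℕ∞) fun x => T x (EuclideanSpace.single p 1) :=
    fun p => hT.clm_apply contDiff_const
  obtain ⟨B, hBdef⟩ : ∃ B, B = n * ε / (2 * (n * δ + α)) := ⟨_, rfl⟩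
  have hB : 0 < B := by rw [hBdef]; positivity
  have key := fun p : Fin n => sum_sq_mul_integral_gradient_le hΩopen hΩbd hη hT hTsym hu hbd horth
    hs hweak hmm' (contDiff_coord contDiff_id p) (hY p) hB
  simp only [id, gradient_coord] at key
  have hsum := Finset.sum_le_sum fun p (_ : p ∈ Finset.univ) => key p
  rw [Finset.sum_add_distrib, ← Finset.mul_sum, ← Finset.mul_sum, Finset.sum_comm,
    Finset.sum_comm (f := fun p i => (σ (Fin.last k) - σ (Fin.castSucc i)) ^ 2 *
      ∫ x, (‖u i x‖ ^ 2 * ⟪T x (EuclideanSpace.single p 1), EuclideanSpace.single p 1⟫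
        + α * ⟪EuclideanSpace.single p 1, u i x⟫ ^ 2) ∂(wMeasure η Ω)),
    Finset.sum_comm (f := fun p i => (σ (Fin.last k) - σ (Fin.castSucc i)) *
      ∫ x, ‖skewDeriv η (fun x => T x (EuclideanSpace.single p 1)) (u i) x‖ ^ 2
        ∂(wMeasure η Ω))] at hsum
  simp only [← Finset.mul_sum] at hsum
  have hlow : ∀ i, n * ε ≤ ∑ p, ∫ x, ‖u i x‖ ^ 2
      * ⟪EuclideanSpace.single p 1, T x (EuclideanSpace.single p 1)⟫ ∂(wMeasure η Ω) := fun i => by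
    have hp : ∀ p : Fin n, ε ≤ ∫ x, ‖u i x‖ ^ 2
        * ⟪EuclideanSpace.single p 1, T x (EuclideanSpace.single p 1)⟫ ∂(wMeasure η Ω) := fun p => by
      have h := integral_mono (hμ (((hu i).norm_sq ℝ).mul (contDiff_const (c := ε))))
        (hμ (((hu i).norm_sq ℝ).mul
          (contDiff_const (c := (EuclideanSpace.single p 1 : En n)).inner ℝ (hY p)))) fun x =>
        mul_le_mul_of_nonneg_left (by
          have := (hell x (EuclideanSpace.single p 1)).1
          rw [real_inner_comm] at this
          simpa using this) (sq_nonneg ‖u i x‖)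
      rwa [integral_mul_const, hnorm, one_mul] at h
    calc (n : ℝ) * ε = ∑ _p : Fin n, ε := by simp
      _ ≤ _ := Finset.sum_le_sum fun p _ => hp p
  have hup : ∀ i, ∑ p, ∫ x, (‖u i x‖ ^ 2
      * ⟪T x (EuclideanSpace.single p 1), EuclideanSpace.single p 1⟫
        + α * ⟪EuclideanSpace.single p 1, u i x⟫ ^ 2) ∂(wMeasure η Ω) ≤ n * δ + α := fun i => by
    have hp : ∀ p : Fin n, ContDiff ℝ (⊤ : ℕ∞) fun x => ‖u i x‖ ^ 2
        * ⟪T x (EuclideanSpace.single p 1), EuclideanSpace.single p 1⟫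
        + α * ⟪EuclideanSpace.single p 1, u i x⟫ ^ 2 := fun p =>
      (((hu i).norm_sq ℝ).mul ((hY p).inner ℝ contDiff_const)).add
        (contDiff_const.mul ((contDiff_const.inner ℝ (hu i)).pow 2))
    rw [← integral_finsetSum _ fun p _ => hμ (hp p)]
    have h := integral_mono (hμ (ContDiff.sum fun p (_ : p ∈ Finset.univ) => hp p))
      (hμ ((contDiff_const (c := n * δ + α)).mul ((hu i).norm_sq ℝ))) fun x => by
        have h1 : ∑ p : Fin n, ⟪EuclideanSpace.single p 1, u i x⟫ ^ 2 = ‖u i x‖ ^ 2 := by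
          simp [EuclideanSpace.norm_sq_eq, EuclideanSpace.inner_single_left]
        have h2 : ∑ p : Fin n, ⟪T x (EuclideanSpace.single p 1), EuclideanSpace.single p 1⟫
            ≤ ∑ _p : Fin n, δ :=
          Finset.sum_le_sum fun p _ => by
            simpa using (hell x (EuclideanSpace.single p 1)).2
        rw [Finset.sum_const, Finset.card_univ, Fintype.card_fin, nsmul_eq_mul] at h2
        have h3 := mul_le_mul_of_nonneg_left h2 (sq_nonneg ‖u i x‖)
        simp only [Finset.sum_add_distrib, ← Finset.mul_sum, h1]
        linarith
    rwa [integral_const_mul, hnorm, mul_one] at h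
  have hskew : ∀ i, ∑ p, ∫ x, ‖skewDeriv η (fun x => T x (EuclideanSpace.single p 1)) (u i) x‖ ^ 2
        ∂(wMeasure η Ω)
      ≤ δ * (σ i.castSucc - α * (∫ x, (vdivEta η (u i) x) ^ 2 ∂(wMeasure η Ω))
        + (T₀ ^ 2 + 4 * C₀) / (4 * δ)) := fun i => by
    have h := sum_integral_norm_skewDeriv_sq_le hΩopen hΩbd hη hT hTsym hpos
      (fun x v => (hell x v).2) hT₀' hC₀' (hu i) (hbd i)
    have hg : ∀ l : Fin n, ContDiff ℝ (⊤ : ℕ∞) fun x => gradient (fun y => u i y l) x :=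
      fun l => contDiff_gradient (contDiff_coord (hu i) l)
    have he := integral_add
      (hμ (ContDiff.sum fun l (_ : l ∈ Finset.univ) => (hT.clm_apply (hg l)).inner ℝ (hg l)))
      (hμ (contDiff_const (c := α) |>.mul ((contDiff_vdivEta hη (hu i)).pow 2)))
    have hw := hweak i _ (hu i) (hbd i)
    simp only [energyDensity, ← sq, real_inner_self_eq_norm_sq, hnorm] at hw
    rw [hw, integral_const_mul] at he
    rw [hnorm] at h
    have hδ' : δ * ((T₀ ^ 2 + 4 * C₀) / (4 * δ)) = C₀ + T₀ ^ 2 / 4 := by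
      field_simp
      ring
    have hE := eq_sub_of_add_eq he.symm
    rw [hE] at h
    linarith
  have hL := Finset.sum_le_sum fun i (_ : i ∈ (Finset.univ : Finset (Fin k))) =>
    mul_le_mul_of_nonneg_left (hlow i) (sq_nonneg (σ (Fin.last k) - σ i.castSucc))
  have hU := Finset.sum_le_sum fun i (_ : i ∈ (Finset.univ : Finset (Fin k))) =>
    mul_le_mul_of_nonneg_left (hup i) (sq_nonneg (σ (Fin.last k) - σ i.castSucc))
  have hS := Finset.sum_le_sum fun i (_ : i ∈ (Finset.univ : Finset (Fin k))) =>
    mul_le_mul_of_nonneg_left (hskew i) (sub_nonneg.2 (hs i))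
  simp only [mul_left_comm _ δ] at hS
  rw [← Finset.sum_mul] at hL hU
  rw [← Finset.mul_sum] at hS
  have hfin := (hL.trans hsum).trans (add_le_add (mul_le_mul_of_nonneg_left hU hB.le)
    (mul_le_mul_of_nonneg_left hS (one_div_pos.2 hB).le))
  generalize (∑ i : Fin k, (σ (Fin.last k) - σ i.castSucc) ^ 2) = S at hfin ⊢
  generalize (∑ i : Fin k, (σ (Fin.last k) - σ i.castSucc) *
    (σ i.castSucc - α * (∫ x, (vdivEta η (u i) x) ^ 2 ∂(wMeasure η Ω))
      + (T₀ ^ 2 + 4 * C₀) / (4 * δ))) = R at hfin ⊢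
  have hBD : B * (S * (n * δ + α)) = S * (n * ε) / 2 := by
    rw [hBdef]
    field_simp
  have hBR : 1 / B * (δ * R) = (n * ε / 2) * ((4 * δ * (n * δ + α) / (n ^ 2 * ε ^ 2)) * R) := by
    rw [hBdef]
    field_simp
    ring
  rw [hBD, hBR] at hfin
  refine le_of_mul_le_mul_left (a := n * ε / 2) ?_ (by positivity)
  linarith

end
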